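/- Consider on the half-plane U = {(x¹,x²) ∈ ℝ² : x¹ > 0} the torsion-free Type B connection with Christoffel symbols Γ_{11}¹ = −1/x¹, Γ_{12}² = Γ_{21}² = −1/x¹, Γ_{22}¹ = 1/x¹, and all other Γ_{ij}^k = 0 (the model N₄³(0), the hyperbolic plane). Then a smooth vector field X on U is an affine Killing vector field for this connection if and only if X lies in the ℝ-linear span of the three vector fields (x¹, x²), (0,1), and (2x¹x², (x²)² − (x¹)²). -/

import Mathlib

open Real

/-- The partial derivative `∂f/∂x^i` of a function on `ℝ²` (points are `Fin 2 → ℝ`). -/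
noncomputable def pd (f : (Fin 2 → ℝ) → ℝ) (i : Fin 2) (p : Fin 2 → ℝ) : ℝ :=
  fderiv ℝ f p (Pi.single i 1)

/-- The affine Killing operator
`K^Γ_{ij}^k(v) = ∂_i∂_j v^k + v^l ∂_l Γ_{ij}^k − Γ_{ij}^l ∂_l v^k + Γ_{il}^k ∂_j v^l + Γ_{lj}^k ∂_i v^l`
(summation over `l`). -/
noncomputable def killingOp (Γ : Fin 2 → Fin 2 → Fin 2 → (Fin 2 → ℝ) → ℝ)
    (v : Fin 2 → (Fin 2 → ℝ) → ℝ) (i j k : Fin 2) (p : Fin 2 → ℝ) : ℝ :=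
  pd (fun q => pd (v k) j q) i p
    + (∑ l : Fin 2, v l p * pd (Γ i j k) l p)
    - (∑ l : Fin 2, Γ i j l p * pd (v k) l p)
    + (∑ l : Fin 2, Γ i l k p * pd (v l) j p)
    + (∑ l : Fin 2, Γ l j k p * pd (v l) i p)

/-- `v` is an affine Killing vector field for the connection `Γ` on `U`:
all eight affine Killing equations hold on `U`. -/
def IsAffineKilling (U : Set (Fin 2 → ℝ))
    (Γ : Fin 2 → Fin 2 → Fin 2 → (Fin 2 → ℝ) → ℝ)
    (v : Fin 2 → (Fin 2 → ℝ) → ℝ) : Prop :=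
  ∀ i j k : Fin 2, ∀ p ∈ U, killingOp Γ v i j k p = 0
section PartialDerivatives

variable {f g : (Fin 2 → ℝ) → ℝ} {U : Set (Fin 2 → ℝ)} {p : Fin 2 → ℝ}

theorem HasFDerivAt.pd_eq {f' : (Fin 2 → ℝ) →L[ℝ] ℝ} (h : HasFDerivAt f f' p) (i : Fin 2) :
    pd f i p = f' (Pi.single i 1) := by
  rw [pd, h.fderiv]

theorem pd_congr (hU : IsOpen U) (h : ∀ q ∈ U, f q = g q) (hp : p ∈ U) (i : Fin 2) :
    pd f i p = pd g i p := by
  have : f =ᶠ[nhds p] g := Filter.eventually_of_mem (hU.mem_nhds hp) h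
  rw [pd, pd, this.fderiv_eq]

theorem pd_const (c : ℝ) (i : Fin 2) : pd (fun _ => c) i p = 0 := by
  simp [pd]

theorem pd_coord (i j : Fin 2) : pd (fun q => q j) i p = (Pi.single i 1 : Fin 2 → ℝ) j := by
  rw [(hasFDerivAt_apply (𝕜 := ℝ) j p).pd_eq]
  rfl

theorem pd_add (hf : DifferentiableAt ℝ f p) (hg : DifferentiableAt ℝ g p) (i : Fin 2) :
    pd (fun q => f q + g q) i p = pd f i p + pd g i p :=
  (hf.hasFDerivAt.add hg.hasFDerivAt).pd_eq i

theorem pd_sub (hf : DifferentiableAt ℝ f p) (hg : DifferentiableAt ℝ g p) (i : Fin 2) :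
    pd (fun q => f q - g q) i p = pd f i p - pd g i p :=
  (hf.hasFDerivAt.sub hg.hasFDerivAt).pd_eq i

theorem pd_mul (hf : DifferentiableAt ℝ f p) (hg : DifferentiableAt ℝ g p) (i : Fin 2) :
    pd (fun q => f q * g q) i p = f p * pd g i p + g p * pd f i p :=
  (hf.hasFDerivAt.mul hg.hasFDerivAt).pd_eq i

theorem pd_div_coord_zero (hf : DifferentiableAt ℝ f p) (hp : p 0 ≠ 0) :
    pd (fun q => f q / q 0) 0 p = pd f 0 p / p 0 - f p / p 0 ^ 2 := by
  have hd : DifferentiableAt ℝ (fun q : Fin 2 → ℝ => q 0) p := differentiableAt_apply 0 p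
  have hm : pd (fun q => (q 0)⁻¹) 0 p = -(p 0 ^ 2)⁻¹ := by
    refine (((hasDerivAt_inv hp).comp_hasFDerivAt p (hasFDerivAt_apply (𝕜 := ℝ) 0 p)).pd_eq _).trans ?_
    simp
  simp only [div_eq_mul_inv]
  rw [pd_mul hf (hd.fun_inv hp), hm]
  ring

theorem pd_div_coord_one (hf : DifferentiableAt ℝ f p) (hp : p 0 ≠ 0) :
    pd (fun q => f q / q 0) 1 p = pd f 1 p / p 0 := by
  have hd : DifferentiableAt ℝ (fun q : Fin 2 → ℝ => q 0) p := differentiableAt_apply 0 p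
  have hm : pd (fun q => (q 0)⁻¹) 1 p = 0 := by
    refine (((hasDerivAt_inv hp).comp_hasFDerivAt p (hasFDerivAt_apply (𝕜 := ℝ) 0 p)).pd_eq _).trans ?_
    simp
  simp only [div_eq_mul_inv]
  rw [pd_mul hf (hd.fun_inv hp), hm]
  ring

theorem contDiffOn_pd (hU : IsOpen U) (hf : ContDiffOn ℝ (⊤ : ℕ∞) f U) (i : Fin 2) :
    ContDiffOn ℝ (⊤ : ℕ∞) (pd f i) U :=
  (hf.fderiv_of_isOpen hU (by simp)).clm_apply contDiffOn_const

theorem pd_comm (hU : IsOpen U) (hf : ContDiffOn ℝ (⊤ : ℕ∞) f U) (hp : p ∈ U) (i j : Fin 2) :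
    pd (pd f j) i p = pd (pd f i) j p := by
  have hd : DifferentiableAt ℝ (fderiv ℝ f) p :=
    ((hf.fderiv_of_isOpen (m := 1) hU (by norm_cast)).contDiffAt (hU.mem_nhds hp)).differentiableAt
      one_ne_zero
  have key : ∀ k l, pd (pd f k) l p
      = fderiv ℝ (fderiv ℝ f) p (Pi.single l 1) (Pi.single k 1) := fun k l => by
    rw [(hd.hasFDerivAt.clm_apply (hasFDerivAt_const (Pi.single k 1) p)).pd_eq (f := pd f k) l]
    simp
  rw [key, key]
  exact ((hf.contDiffAt (hU.mem_nhds hp)).isSymmSndFDerivAt 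
    (by simpa using WithTop.coe_le_coe.2 (le_top : (2 : ℕ∞) ≤ ⊤))).eq _ _

theorem exists_eq_const_of_pd_eq_zero (hU : IsOpen U) (hc : Convex ℝ U)
    (hf : DifferentiableOn ℝ f U) (h0 : ∀ q ∈ U, pd f 0 q = 0) (h1 : ∀ q ∈ U, pd f 1 q = 0) :
    ∃ c, ∀ q ∈ U, f q = c := by
  refine hU.exists_is_const_of_fderiv_eq_zero hc.isPreconnected hf fun q hq => ?_
  refine ContinuousLinearMap.coe_injective (LinearMap.pi_ext' fun i => LinearMap.ext_ring ?_)
  fin_cases i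
  · exact h0 q hq
  · exact h1 q hq

end PartialDerivatives

theorem isOpen_rightHalfPlane : IsOpen {p : Fin 2 → ℝ | 0 < p 0} :=
  isOpen_lt continuous_const (continuous_apply 0)

theorem convex_rightHalfPlane : Convex ℝ {p : Fin 2 → ℝ | 0 < p 0} :=
  convex_halfSpace_gt (LinearMap.proj (R := ℝ) (φ := fun _ : Fin 2 => ℝ) 0).isLinear 0

/-- The affine Killing equations of the hyperbolic plane, written out in components. -/
theorem isAffineKilling_hyperbolic_iff (v : Fin 2 → (Fin 2 → ℝ) → ℝ) :
    IsAffineKilling {p : Fin 2 → ℝ | 0 < p 0}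
      (fun i j k => fun p : Fin 2 → ℝ =>
        ![![![(-1 : ℝ), 0], ![0, -1]], ![![0, -1], ![1, 0]]] i j k / p 0) v
    ↔ ∀ p : Fin 2 → ℝ, 0 < p 0 →
      pd (pd (v 0) 0) 0 p + v 0 p / p 0 ^ 2 - pd (v 0) 0 p / p 0 = 0
      ∧ pd (pd (v 1) 0) 0 p - pd (v 1) 0 p / p 0 = 0
      ∧ pd (pd (v 0) 1) 0 p + pd (v 1) 0 p / p 0 = 0
      ∧ pd (pd (v 1) 1) 0 p + v 0 p / p 0 ^ 2 - pd (v 0) 0 p / p 0 = 0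
      ∧ pd (pd (v 0) 0) 1 p + pd (v 1) 0 p / p 0 = 0
      ∧ pd (pd (v 1) 0) 1 p + v 0 p / p 0 ^ 2 - pd (v 0) 0 p / p 0 = 0
      ∧ pd (pd (v 0) 1) 1 p - v 0 p / p 0 ^ 2 - pd (v 0) 0 p / p 0 + 2 * pd (v 1) 1 p / p 0 = 0
      ∧ pd (pd (v 1) 1) 1 p - pd (v 1) 0 p / p 0 - 2 * pd (v 0) 1 p / p 0 = 0 := by
  have h0 : ∀ (m : ℝ) (p : Fin 2 → ℝ), 0 < p 0 →
      pd (fun q => m / q 0) 0 p = -(m / p 0 ^ 2) := fun m p hp => by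
    rw [pd_div_coord_zero (differentiableAt_const m) hp.ne', pd_const]; ring
  have h1 : ∀ (m : ℝ) (p : Fin 2 → ℝ), 0 < p 0 →
      pd (fun q => m / q 0) 1 p = 0 := fun m p hp => by
    rw [pd_div_coord_one (differentiableAt_const m) hp.ne', pd_const]; ring
  constructor
  · intro h p hp
    have K := fun i j k => h i j k p hp
    simp only [killingOp, Fin.sum_univ_two, h0 _ p hp, h1 _ p hp] at K
    have K000 := K 0 0 0
    have K001 := K 0 0 1
    have K010 := K 0 1 0
    have K011 := K 0 1 1
    have K100 := K 1 0 0
    have K101 := K 1 0 1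
    have K110 := K 1 1 0
    have K111 := K 1 1 1
    simp only [Matrix.cons_val_zero, Matrix.cons_val_one] at K000 K001 K010 K011 K100 K101 K110 K111
    refine ⟨?_, ?_, ?_, ?_, ?_, ?_, ?_, ?_⟩
    · linear_combination K000
    · linear_combination K001
    · linear_combination K010
    · linear_combination K011
    · linear_combination K100
    · linear_combination K101
    · linear_combination K110
    · linear_combination K111
  · intro h i j k p hp
    obtain ⟨K000, K001, K010, K011, K100, K101, K110, K111⟩ := h p hp
    simp only [killingOp, Fin.sum_univ_two, h0 _ p hp, h1 _ p hp]
    fin_cases i <;> fin_cases j <;> fin_cases k <;>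
      simp only [Fin.zero_eta, Fin.mk_one, Matrix.cons_val_zero, Matrix.cons_val_one]
    · linear_combination K000
    · linear_combination K001
    · linear_combination K010
    · linear_combination K011
    · linear_combination K100
    · linear_combination K101
    · linear_combination K110
    · linear_combination K111

theorem isAffineKilling_hyperbolic_of_eq {v : Fin 2 → (Fin 2 → ℝ) → ℝ} {a b c : ℝ}
    (h : ∀ p ∈ {p : Fin 2 → ℝ | 0 < p 0}, v 0 p = a * p 0 + c * (2 * p 0 * p 1)
      ∧ v 1 p = a * p 1 + b + c * ((p 1) ^ 2 - (p 0) ^ 2)) :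
    IsAffineKilling {p : Fin 2 → ℝ | 0 < p 0}
      (fun i j k => fun p : Fin 2 → ℝ =>
        ![![![(-1 : ℝ), 0], ![0, -1]], ![![0, -1], ![1, 0]]] i j k / p 0) v := by
  have hU := isOpen_rightHalfPlane
  have linear : ∀ r s t i (p : Fin 2 → ℝ),
      pd (fun q => r + s * q 0 + t * q 1) i p = ![s, t] i := fun r s t i p => by
    rw [pd_add (by fun_prop) (by fun_prop), pd_add (by fun_prop) (by fun_prop),
      pd_mul (by fun_prop) (by fun_prop), pd_mul (by fun_prop) (by fun_prop)]
    fin_cases i <;> simp [pd_const, pd_coord]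
  have hu0 : ∀ p ∈ {p : Fin 2 → ℝ | 0 < p 0}, pd (v 0) 0 p = a + 0 * p 0 + 2 * c * p 1 := by
    intro p hp
    rw [pd_congr hU (g := fun q => q 0 * (a + 0 * q 0 + 2 * c * q 1))
      (fun q hq => by rw [(h q hq).1]; ring) hp, pd_mul (by fun_prop) (by fun_prop), linear]
    simp [pd_coord]
  have hu1 : ∀ p ∈ {p : Fin 2 → ℝ | 0 < p 0}, pd (v 0) 1 p = 0 + 2 * c * p 0 + 0 * p 1 := by
    intro p hp
    rw [pd_congr hU (g := fun q => q 0 * (a + 0 * q 0 + 2 * c * q 1))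
      (fun q hq => by rw [(h q hq).1]; ring) hp, pd_mul (by fun_prop) (by fun_prop), linear]
    simp [pd_coord]; ring
  have hw : ∀ q ∈ {p : Fin 2 → ℝ | 0 < p 0}, v 1 q =
      (b + 0 * q 0 + a * q 1) + (0 + -c * q 0 + c * q 1) * (0 + 1 * q 0 + 1 * q 1) :=
    fun q hq => by rw [(h q hq).2]; ring
  have hw0 : ∀ p ∈ {p : Fin 2 → ℝ | 0 < p 0}, pd (v 1) 0 p = 0 + -2 * c * p 0 + 0 * p 1 := by
    intro p hp
    rw [pd_congr hU hw hp, pd_add (by fun_prop) (by fun_prop), pd_mul (by fun_prop) (by fun_prop)]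
    simp only [linear, Matrix.cons_val_zero]
    ring
  have hw1 : ∀ p ∈ {p : Fin 2 → ℝ | 0 < p 0}, pd (v 1) 1 p = a + 0 * p 0 + 2 * c * p 1 := by
    intro p hp
    rw [pd_congr hU hw hp, pd_add (by fun_prop) (by fun_prop), pd_mul (by fun_prop) (by fun_prop)]
    simp only [linear, Matrix.cons_val_one, Matrix.cons_val_zero]
    ring
  rw [isAffineKilling_hyperbolic_iff]
  intro p hp
  have hp' : p 0 ≠ 0 := hp.ne'
  simp only [pd_congr hU hu0 hp, pd_congr hU hu1 hp, pd_congr hU hw0 hp, pd_congr hU hw1 hp,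
    linear, hu0 p hp, hu1 p hp, hw0 p hp, hw1 p hp, (h p hp).1, Matrix.cons_val_zero,
    Matrix.cons_val_one]
  refine ⟨?_, ?_, ?_, ?_, ?_, ?_, ?_, ?_⟩ <;> field_simp <;> ring

theorem stmt19
    (v : Fin 2 → (Fin 2 → ℝ) → ℝ)
    (hv : ∀ i : Fin 2, ContDiffOn ℝ (⊤ : ℕ∞) (v i) {p : Fin 2 → ℝ | 0 < p 0}) :
    IsAffineKilling {p : Fin 2 → ℝ | 0 < p 0}
      (fun i j k => fun p : Fin 2 → ℝ =>
        ![![![(-1 : ℝ), 0], ![0, -1]], ![![0, -1], ![1, 0]]] i j k / p 0) v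
    ↔ ∃ a b c : ℝ, ∀ p ∈ {p : Fin 2 → ℝ | 0 < p 0},
        v 0 p = a * p 0 + c * (2 * p 0 * p 1)
        ∧ v 1 p = a * p 1 + b + c * ((p 1) ^ 2 - (p 0) ^ 2) := by
  refine ⟨fun h => ?_, fun ⟨a, b, c, h⟩ => isAffineKilling_hyperbolic_of_eq h⟩
  rw [isAffineKilling_hyperbolic_iff] at h
  have hU := isOpen_rightHalfPlane
  set U := {p : Fin 2 → ℝ | 0 < p 0}
  have diff : ∀ {f : (Fin 2 → ℝ) → ℝ}, ContDiffOn ℝ (⊤ : ℕ∞) f U →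
      ∀ p ∈ U, DifferentiableAt ℝ f p := fun hf p hp =>
    (hf.contDiffAt (hU.mem_nhds hp)).differentiableAt (by simp)
  have ne : ∀ p ∈ U, p 0 ≠ 0 := fun p hp => ne_of_gt hp
  have hdiv : ∀ {f : (Fin 2 → ℝ) → ℝ}, ContDiffOn ℝ (⊤ : ℕ∞) f U →
      ∀ p ∈ U, DifferentiableAt ℝ (fun q => f q / q 0) p := fun hf p hp => by
    simp only [div_eq_mul_inv]
    exact (diff hf p hp).fun_mul ((differentiableAt_apply 0 p).fun_inv (ne p hp))
  have hv' := fun k i => contDiffOn_pd hU (hv k) i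
  -- Equality of the mixed third derivatives of `v 1` forces `v 0` to be homogeneous in `p 0`.
  have hu0 : ∀ p ∈ U, pd (v 0) 0 p = v 0 p / p 0 := by
    intro p hp
    have hx := ne p hp
    have e1 : pd (pd (pd (v 1) 0) 0) 1 p = pd (pd (v 1) 0) 1 p / p 0 := by
      rw [pd_congr hU (g := fun q => pd (v 1) 0 q / q 0)
        (fun q hq => by linarith [(h q hq).2.1]) hp, pd_div_coord_one (diff (hv' 1 0) p hp) hx]
    have e2 : pd (pd (pd (v 1) 0) 1) 0 p =
        (pd (pd (v 0) 0) 0 p - (pd (v 0) 0 p / p 0 - v 0 p / p 0 ^ 2)) / p 0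
          - (pd (v 0) 0 p - v 0 p / p 0) / p 0 ^ 2 := by
      have hq0 : DifferentiableAt ℝ (fun q : Fin 2 → ℝ => v 0 q / q 0) p :=
        hdiv (hv 0) p hp
      rw [pd_congr hU (g := fun q => (pd (v 0) 0 q - v 0 q / q 0) / q 0)
        (fun q hq => by
          have := (h q hq).2.2.2.2.2.1
          have hq := ne q hq
          field_simp at this ⊢
          linarith) hp,
        pd_div_coord_zero ((diff (hv' 0 0) p hp).fun_sub hq0) hx,
        pd_sub (diff (hv' 0 0) p hp) hq0, pd_div_coord_zero (diff (hv 0) p hp) hx]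
    have e3 := pd_comm hU (hv' 1 0) hp 1 0
    have k1 := (h p hp).1
    have k2 := (h p hp).2.2.2.2.2.1
    rw [e1, e2] at e3
    have k1' : pd (pd (v 0) 0) 0 p = pd (v 0) 0 p / p 0 - v 0 p / p 0 ^ 2 := by linarith
    have k2' : pd (pd (v 1) 0) 1 p = pd (v 0) 0 p / p 0 - v 0 p / p 0 ^ 2 := by linarith
    rw [k1', k2'] at e3
    field_simp at e3 ⊢
    linarith
  have hC : ∃ c, ∀ p ∈ U, pd (v 1) 0 p / p 0 = c := by
    refine exists_eq_const_of_pd_eq_zero hU convex_rightHalfPlane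
      (fun p hp => (hdiv (hv' 1 0) p hp).differentiableWithinAt)
      (fun p hp => ?_) (fun p hp => ?_)
    · have k := (h p hp).2.1
      have hx := ne p hp
      rw [pd_div_coord_zero (diff (hv' 1 0) p hp) hx]
      field_simp at k ⊢
      linarith
    · have k := (h p hp).2.2.2.2.2.1
      have hx := ne p hp
      rw [pd_div_coord_one (diff (hv' 1 0) p hp) hx]
      rw [hu0 p hp] at k
      have k' : pd (pd (v 1) 0) 1 p = 0 := by linear_combination k
      rw [k', zero_div]
  obtain ⟨m, hm⟩ := hC
  have hu1 : ∀ p ∈ U, pd (v 0) 1 p = -m * p 0 := by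
    intro p hp
    have k := (h p hp).2.2.2.2.1
    have hx := ne p hp
    rw [hm p hp, pd_congr hU hu0 hp, pd_div_coord_one (diff (hv 0) p hp) hx] at k
    field_simp at k
    linarith
  have hA : ∃ a, ∀ p ∈ U, v 0 p / p 0 + m * p 1 = a := by
    refine exists_eq_const_of_pd_eq_zero hU convex_rightHalfPlane
      (fun p hp => ((hdiv (hv 0) p hp).add (by fun_prop)).differentiableWithinAt)
      (fun p hp => ?_) (fun p hp => ?_)
    · rw [pd_add (hdiv (hv 0) p hp) (by fun_prop), pd_div_coord_zero (diff (hv 0) p hp) (ne p hp),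
        pd_mul (by fun_prop) (by fun_prop), hu0 p hp]
      simp [pd_const, pd_coord]
      ring
    · have hx := ne p hp
      rw [pd_add (hdiv (hv 0) p hp) (by fun_prop), pd_div_coord_one (diff (hv 0) p hp) hx,
        pd_mul (by fun_prop) (by fun_prop), hu1 p hp]
      simp [pd_const, pd_coord]
      field_simp
      ring
  obtain ⟨a, ha⟩ := hA
  have hu : ∀ p ∈ U, v 0 p / p 0 = a - m * p 1 := fun p hp => by linarith [ha p hp]
  have hw1 : ∀ p ∈ U, pd (v 1) 1 p = a - m * p 1 := by
    intro p hp
    have k := (h p hp).2.2.2.2.2.2.1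
    have hx := ne p hp
    rw [pd_congr hU hu1 hp, pd_mul (by fun_prop) (by fun_prop), pd_const, pd_coord,
      hu0 p hp] at k
    rw [← hu p hp]
    simp only [Pi.single_apply] at k
    norm_num at k
    field_simp at k ⊢
    linarith
  have hB : ∃ b, ∀ p ∈ U, v 1 p - (a * p 1 + m / 2 * (p 0 * p 0 - p 1 * p 1)) = b := by
    refine exists_eq_const_of_pd_eq_zero hU convex_rightHalfPlane
      (fun p hp => ((diff (hv 1) p hp).sub (by fun_prop)).differentiableWithinAt)
      (fun p hp => ?_) (fun p hp => ?_)
    all_goals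
      rw [pd_sub (diff (hv 1) p hp) (by fun_prop), pd_add (by fun_prop) (by fun_prop),
        pd_mul (by fun_prop) (by fun_prop), pd_mul (by fun_prop) (by fun_prop),
        pd_sub (by fun_prop) (by fun_prop), pd_mul (by fun_prop) (by fun_prop),
        pd_mul (by fun_prop) (by fun_prop)]
    · have k := hm p hp
      rw [div_eq_iff (ne p hp)] at k
      simp [pd_const, pd_coord, k]
      ring
    · simp [pd_const, pd_coord, hw1 p hp]
      ring
  obtain ⟨b, hb⟩ := hB
  refine ⟨a, b, -m / 2, fun p hp => ⟨?_, ?_⟩⟩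
  · have := hu p hp
    rw [div_eq_iff (ne p hp)] at this
    linarith
  · linarith [hb p hp]
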